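/- Let T = [A,B,C]_R be an I×J×K real tensor. Suppose that k_A + r_B + k_C ≥ 2R + 2 and k_B + k_C ≥ R + 2. Then the rank of T equals R and the CPD of T is unique. -/

import Mathlib

open scoped BigOperators

noncomputable section

/-- The k-rank of a matrix: the largest `k` such that every subset of `k` columns is
linearly independent. -/
noncomputable def kRank {α β : Type*} [Fintype α] [Fintype β] (A : Matrix α β ℝ) : ℕ :=
  sSup {k | k ≤ Fintype.card β ∧
    ∀ s : Finset β, s.card = k → LinearIndependent ℝ fun j : s => fun i : α => A i j.1}

/-- The `I × J × K` tensor `[A, B, C]_R` built from factor matrices `A`, `B`, `C`: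
`t i j k = ∑ r, A i r * B j r * C k r`. -/
def cpdTensor {I J K R : ℕ} (A : Matrix (Fin I) (Fin R) ℝ) (B : Matrix (Fin J) (Fin R) ℝ)
    (C : Matrix (Fin K) (Fin R) ℝ) : Fin I → Fin J → Fin K → ℝ :=
  fun i j k => ∑ r, A i r * B j r * C k r

/-- The rank of a third-order tensor: the minimal number of rank-1 terms whose sum is `T`. -/
noncomputable def tensorRank {I J K : ℕ} (T : Fin I → Fin J → Fin K → ℝ) : ℕ :=
  sInf {n | ∃ A B C, T = cpdTensor (R := n) A B C}

/-- Uniqueness of the CPD with `R` terms: any two representations of `T` as a sum of `R`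
rank-1 terms coincide up to a common permutation of the terms and scalings of the columns
whose product is `1` within each term. -/
def cpdUnique {I J K : ℕ} (R : ℕ) (T : Fin I → Fin J → Fin K → ℝ) : Prop :=
  ∀ (A A' : Matrix (Fin I) (Fin R) ℝ) (B B' : Matrix (Fin J) (Fin R) ℝ)
    (C C' : Matrix (Fin K) (Fin R) ℝ),
    T = cpdTensor A B C → T = cpdTensor A' B' C' →
    ∃ (σ : Equiv.Perm (Fin R)) (la lb lc : Fin R → ℝ),
      (∀ r, la r * lb r * lc r = 1) ∧
      (∀ i r, A' i r = la r * A i (σ r)) ∧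
      (∀ j r, B' j r = lb r * B j (σ r)) ∧
      (∀ k r, C' k r = lc r * C k (σ r))

section PermutationLemma

open Module Submodule

variable {K E ι : Type*} [Field K] [AddCommGroup E] [Module K E] [FiniteDimensional K E]
  [Fintype ι]

open scoped Classical in
/-- If every functional vanishing on sufficiently many of the vectors `c' j` vanishes on at least
as many of the vectors `c j`, then every proper flat spanned by some of the `c' j` contains at least
as many of the `c j` as of the `c' j`. -/
theorem card_mem_flat_le (c c' : ι → E) (k : ℕ)
    (hk : k ≤ finrank K (span K (Set.range c')))
    (hsub : ∀ j, c j ∈ span K (Set.range c'))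
    (hW : ∀ φ : E →ₗ[K] K, (Finset.univ.filter fun j => φ (c' j) ≠ 0).card + k ≤ Fintype.card ι + 1 →
      (Finset.univ.filter fun j => φ (c j) ≠ 0).card ≤
        (Finset.univ.filter fun j => φ (c' j) ≠ 0).card)
    (F : Submodule K E) (hF : F ≤ span K (c' '' {j | c' j ∈ F}))
    (hlt : F < span K (Set.range c')) :
    (Finset.univ.filter fun j => c' j ∈ F).card ≤ (Finset.univ.filter fun j => c j ∈ F).card := by
  induction F using WellFoundedGT.induction with
  | ind F ih =>
  set V := span K (Set.range c') with hV
  have hcV : ∀ j, c' j ∈ V := fun j => subset_span ⟨j, rfl⟩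
  let G : ι → Submodule K E := fun j => span K {c' j} ⊔ F
  have hmemG : ∀ j, c' j ∈ G j := fun j => mem_sup_left (mem_span_singleton_self _)
  have hcov : ∀ j, c' j ∉ F → F ⋖ G j := fun j hj => covBy_span_singleton_sup hj
  have hGV : ∀ j, G j ≤ V := fun j =>
    sup_le ((span_singleton_le_iff_mem _ _).2 (hcV j)) hlt.le
  have huniq : ∀ j, c' j ∉ F → ∀ v ∈ G j, v ∉ F → span K {v} ⊔ F = G j := by
    intro j hj v hv hvF
    refine ((hcov j hj).eq_or_eq le_sup_right
      (sup_le ((span_singleton_le_iff_mem _ _).2 hv) le_sup_right)).resolve_left fun h => hvF ?_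
    rw [← h]
    exact mem_sup_left (mem_span_singleton_self _)
  obtain ⟨j₀, hj₀⟩ : ∃ j, c' j ∉ F := by
    by_contra! h
    exact hlt.not_ge (span_le.2 (by rintro _ ⟨j, rfl⟩; exact h j))
  by_cases hA : ∃ j, G j = V
  · obtain ⟨j, hj⟩ := hA
    have hjF : c' j ∉ F := by
      intro h
      refine hlt.ne ?_
      rw [← hj]
      exact (sup_eq_right.2 ((span_singleton_le_iff_mem _ _).2 h)).symm
    obtain ⟨φ, hφj, hφF⟩ := exists_le_ker_of_notMem hjF
    have hiff : ∀ v ∈ V, v ∈ F ↔ φ v = 0 := by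
      intro v hv
      refine ⟨fun h => hφF h, fun h => ?_⟩
      rw [← hj] at hv
      obtain ⟨y, hy, z, hz, rfl⟩ := mem_sup.1 hv
      obtain ⟨t, rfl⟩ := mem_span_singleton.1 hy
      have hz0 : φ z = 0 := hφF hz
      simp only [map_add, map_smul, hz0, add_zero, smul_eq_mul, mul_eq_zero, hφj, or_false] at h
      simpa [h] using hz
    have h1 : (Finset.univ.filter fun j => c' j ∈ F) = Finset.univ.filter fun j => φ (c' j) = 0 :=
      Finset.filter_congr fun j _ => hiff _ (hcV j)
    have h2 : (Finset.univ.filter fun j => c j ∈ F) = Finset.univ.filter fun j => φ (c j) = 0 :=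
      Finset.filter_congr fun j _ => hiff _ (hsub j)
    have e1 := Finset.card_filter_add_card_filter_not (s := Finset.univ) fun j => φ (c' j) = 0
    have e2 := Finset.card_filter_add_card_filter_not (s := Finset.univ) fun j => φ (c j) = 0
    rw [Finset.card_univ] at e1 e2
    have hFcard : finrank K F ≤ (Finset.univ.filter fun j => c' j ∈ F).card := by
      refine (Submodule.finrank_mono hF).trans ?_
      have := finrank_span_finset_le_card (R := K)
        ((Finset.univ.filter fun j => c' j ∈ F).image c')
      rw [Set.finrank, Finset.coe_image, Finset.coe_filter_univ] at this
      exact this.trans Finset.card_image_le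
    have hVF : finrank K V ≤ finrank K F + 1 := by
      rw [← hj, add_comm]
      exact (Submodule.finrank_add_le_finrank_add_finrank _ _).trans
        (Nat.add_le_add_right ((finrank_span_le_card {c' j}).trans (by simp)) _)
    have := hW φ (by rw [h1] at hFcard; simp only [ne_eq]; omega)
    rw [h1, h2]
    simp only [ne_eq] at this
    omega
  · push Not at hA
    set 𝒢 : Finset (Submodule K E) := (Finset.univ.filter fun j => c' j ∉ F).image G with h𝒢
    have hle : ∀ g ∈ 𝒢, (Finset.univ.filter fun j => c' j ∈ g).card ≤
        (Finset.univ.filter fun j => c j ∈ g).card := by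
      intro g hg
      obtain ⟨j, hj, rfl⟩ := Finset.mem_image.1 hg
      have hj : c' j ∉ F := by simpa using hj
      refine ih _ (hcov j hj).lt ?_ (lt_of_le_of_ne (hGV j) (hA j))
      refine sup_le ?_ (hF.trans (span_mono (Set.image_mono fun i hi => ?_)))
      · exact span_mono (Set.singleton_subset_iff.2 ⟨j, hmemG j, rfl⟩)
      · exact (le_sup_right : F ≤ G j) hi
    have hFg : ∀ g ∈ 𝒢, F ≤ g := by
      intro g hg
      obtain ⟨j, hj, rfl⟩ := Finset.mem_image.1 hg
      exact le_sup_right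
    have hsplit : ∀ (d : ι → E), ∀ g ∈ 𝒢, (Finset.univ.filter fun j => d j ∈ g).card =
        (Finset.univ.filter fun j => d j ∈ F).card +
          (Finset.univ.filter fun j => d j ∉ F ∧ d j ∈ g).card := by
      intro d g hg
      rw [← Finset.card_union_of_disjoint]
      · congr 1
        ext j
        have := @hFg g hg (d j)
        simp only [Finset.mem_filter, Finset.mem_univ, true_and, Finset.mem_union]
        tauto
      · refine Finset.disjoint_filter.2 fun j _ h h' => h'.1 h
    have s1 : ∑ g ∈ 𝒢, (Finset.univ.filter fun j => c' j ∉ F ∧ c' j ∈ g).card =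
        (Finset.univ.filter fun j => c' j ∉ F).card := by
      rw [Finset.card_eq_sum_card_image G]
      refine Finset.sum_congr rfl fun g hg => ?_
      obtain ⟨i, hi, rfl⟩ := Finset.mem_image.1 hg
      have hi : c' i ∉ F := by simpa using hi
      congr 1
      ext j
      simp only [Finset.mem_filter, Finset.mem_univ, true_and]
      refine and_congr_right fun hj => ⟨fun h => huniq i hi _ h hj, fun h => h ▸ hmemG j⟩
    have s2 : ∑ g ∈ 𝒢, (Finset.univ.filter fun j => c j ∉ F ∧ c j ∈ g).card ≤
        (Finset.univ.filter fun j => c j ∉ F).card := by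
      rw [← Finset.card_biUnion]
      · refine Finset.card_le_card fun j hj => ?_
        simp only [Finset.mem_biUnion, Finset.mem_filter, Finset.mem_univ, true_and] at hj ⊢
        obtain ⟨_, _, h, _⟩ := hj
        exact h
      · intro g hg g' hg' hne
        refine Finset.disjoint_filter.2 fun j _ h h' => hne ?_
        obtain ⟨i, hi, rfl⟩ := Finset.mem_image.1 hg
        obtain ⟨i', hi', rfl⟩ := Finset.mem_image.1 hg'
        rw [← huniq i (by simpa using hi) _ h.2 h.1, ← huniq i' (by simpa using hi') _ h'.2 h.1]
    have h𝒢2 : 1 < 𝒢.card := by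
      obtain ⟨i, hi⟩ : ∃ i, c' i ∉ G j₀ := by
        by_contra! h
        exact hA j₀ (le_antisymm (hGV _) (span_le.2 (by rintro _ ⟨j, rfl⟩; exact h j)))
      refine Finset.one_lt_card.2 ⟨G j₀, ?_, G i, ?_, fun h => hi (h ▸ hmemG i)⟩
      · exact Finset.mem_image_of_mem _ (by simpa using hj₀)
      · exact Finset.mem_image_of_mem _
          (by simpa using fun h => hi ((le_sup_right : F ≤ G j₀) h))
    have e1 := Finset.card_filter_add_card_filter_not (s := Finset.univ) fun j => c' j ∈ F
    have e2 := Finset.card_filter_add_card_filter_not (s := Finset.univ) fun j => c j ∈ F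
    rw [Finset.card_univ] at e1 e2
    have hs := Finset.sum_le_sum hle
    rw [Finset.sum_congr rfl (hsplit c'), Finset.sum_congr rfl (hsplit c), Finset.sum_add_distrib,
      Finset.sum_add_distrib, s1, Finset.sum_const, Finset.sum_const, smul_eq_mul, smul_eq_mul] at hs
    obtain ⟨t, ht⟩ := Nat.exists_eq_add_of_lt h𝒢2
    rw [ht] at hs
    by_contra! hcon
    nlinarith

open scoped Classical in
/-- **Kruskal's permutation lemma.** -/
theorem exists_perm_smul_of_card_le (c c' : ι → E) (k : ℕ) (hk2 : 2 ≤ k)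
    (hk : k ≤ finrank K (span K (Set.range c))) (hc0 : ∀ j, c j ≠ 0)
    (hpair : ∀ i j, ∀ v : E, c i ∈ span K {v} → c j ∈ span K {v} → i = j)
    (hW : ∀ φ : E →ₗ[K] K, (Finset.univ.filter fun j => φ (c' j) ≠ 0).card + k ≤ Fintype.card ι + 1 →
      (Finset.univ.filter fun j => φ (c j) ≠ 0).card ≤
        (Finset.univ.filter fun j => φ (c' j) ≠ 0).card) :
    ∃ (σ : Equiv.Perm ι) (μ : ι → K), ∀ j, μ j ≠ 0 ∧ c' j = μ j • c (σ j) := by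
  have hsub : ∀ j, c j ∈ span K (Set.range c') := by
    intro j
    by_contra hj
    obtain ⟨φ, hφj, hφ⟩ := exists_le_ker_of_notMem hj
    have h0 : (Finset.univ.filter fun j => φ (c' j) ≠ 0) = ∅ :=
      Finset.filter_eq_empty_iff.2 fun i _ => not_not.2 (hφ (subset_span ⟨i, rfl⟩))
    have hkc : k ≤ Fintype.card ι := hk.trans (finrank_range_le_card c)
    have := hW φ (by rw [h0, Finset.card_empty]; omega)
    rw [h0, Finset.card_empty, Nat.le_zero, Finset.card_eq_zero, Finset.filter_eq_empty_iff] at this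
    exact this (Finset.mem_univ j) hφj
  have hk' : k ≤ finrank K (span K (Set.range c')) :=
    hk.trans (Submodule.finrank_mono (span_le.2 (by rintro _ ⟨j, rfl⟩; exact hsub j)))
  have hflat := card_mem_flat_le c c' k hk' hsub hW
  have h0 : ∀ j, c' j ≠ 0 := by
    intro j hj
    have := hflat ⊥ bot_le (bot_lt_iff_ne_bot.2 fun h => by
      rw [h, finrank_bot] at hk'; omega)
    have he : (Finset.univ.filter fun j => c j ∈ (⊥ : Submodule K E)) = ∅ :=
      Finset.filter_eq_empty_iff.2 fun i _ h => hc0 i (by simpa using h)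
    rw [he, Finset.card_empty, Nat.le_zero, Finset.card_eq_zero, Finset.filter_eq_empty_iff] at this
    exact this (Finset.mem_univ j) (by simpa using hj)
  have hline : ∀ j, (Finset.univ.filter fun i => c' i ∈ span K {c' j}).card ≤
      (Finset.univ.filter fun i => c i ∈ span K {c' j}).card := by
    intro j
    refine hflat _ (span_mono (Set.singleton_subset_iff.2 ⟨j, mem_span_singleton_self _, rfl⟩)) ?_
    refine lt_of_le_of_ne (span_mono (Set.singleton_subset_iff.2 ⟨j, rfl⟩)) fun h => ?_
    rw [← h] at hk'
    have : finrank K (span K {c' j}) ≤ 1 := (finrank_span_le_card {c' j}).trans (by simp)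
    omega
  have hex : ∀ j, ∃ i, c i ∈ span K {c' j} := by
    intro j
    have h1 : 0 < (Finset.univ.filter fun i => c' i ∈ span K {c' j}).card :=
      Finset.card_pos.2 ⟨j, by simp⟩
    obtain ⟨i, hi⟩ := Finset.card_pos.1 (h1.trans_le (hline j))
    exact ⟨i, by simpa using hi⟩
  choose s hs using hex
  have hμ : ∀ j, ∃ μ : K, μ ≠ 0 ∧ c' j = μ • c (s j) := by
    intro j
    obtain ⟨a, ha⟩ := mem_span_singleton.1 (hs j)
    have ha0 : a ≠ 0 := by
      rintro rfl
      exact hc0 (s j) (by rw [← ha, zero_smul])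
    exact ⟨a⁻¹, inv_ne_zero ha0, by rw [← ha, inv_smul_smul₀ ha0]⟩
  choose μ hμ0 hμ using hμ
  have hinj : Function.Injective s := by
    intro i j hij
    have h1 : (Finset.univ.filter fun i => c i ∈ span K {c' j}).card ≤ 1 :=
      Finset.card_le_one.2 fun a ha b hb => hpair a b _ (by simpa using ha) (by simpa using hb)
    refine Finset.card_le_one.1 ((hline j).trans h1) i ?_ j ?_
    · have : c' i ∈ span K {c' j} := by
        rw [hμ i, hij]
        exact smul_mem _ _ (hs j)
      simpa using this
    · simp
  exact ⟨Equiv.ofBijective s (Finite.injective_iff_bijective.1 hinj), μ, fun j => ⟨hμ0 j, hμ j⟩⟩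

end PermutationLemma

section KRank

variable {α β : Type*} [Fintype α] [Fintype β]

theorem kRank_mem (A : Matrix α β ℝ) :
    kRank A ∈ {k | k ≤ Fintype.card β ∧
      ∀ s : Finset β, s.card = k → LinearIndependent ℝ fun j : s => fun i : α => A i j.1} := by
  refine Nat.sSup_mem ⟨0, Nat.zero_le _, fun s hs => ?_⟩ ⟨Fintype.card β, fun k hk => hk.1⟩
  obtain rfl := Finset.card_eq_zero.1 hs
  exact linearIndependent_empty_type

theorem kRank_le_card (A : Matrix α β ℝ) : kRank A ≤ Fintype.card β := (kRank_mem A).1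

theorem linearIndepOn_col_of_card_le_kRank (A : Matrix α β ℝ) {s : Finset β}
    (hs : s.card ≤ kRank A) : LinearIndepOn ℝ A.col (s : Set β) := by
  obtain ⟨t, hst, ht⟩ := Finset.exists_superset_card_eq hs (kRank_le_card A)
  have : LinearIndepOn ℝ A.col (t : Set β) := (kRank_mem A).2 t ht
  exact this.mono (by exact_mod_cast hst)

theorem finrank_span_col_image (A : Matrix α β ℝ) {s : Finset β} (hs : s.card ≤ kRank A) :
    Module.finrank ℝ (Submodule.span ℝ (A.col '' (s : Set β))) = s.card := by
  rw [Set.image_eq_range]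
  exact (finrank_span_eq_card (linearIndepOn_col_of_card_le_kRank A hs)).trans (by simp)

variable [DecidableEq β]

/-- Columns indexed by a set of at most `kRank A` elements admit a dual system. -/
theorem exists_mulVec_col_eq_single (A : Matrix α β ℝ) {s : Finset β} (hs : s.card ≤ kRank A) :
    ∃ L : Matrix β α ℝ, ∀ j ∈ s, L.mulVec (A.col j) = Pi.single j 1 := by
  classical
  have hli : LinearIndependent ℝ fun j : s => A.col j := linearIndepOn_col_of_card_le_kRank A hs
  let b := Module.Basis.span hli
  obtain ⟨g, hg⟩ := LinearMap.exists_extend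
    (b.constr ℝ fun j : s => (Pi.single j.1 1 : β → ℝ))
  refine ⟨LinearMap.toMatrix' g, fun j hj => ?_⟩
  rw [LinearMap.toMatrix'_mulVec]
  have h := LinearMap.congr_fun hg (b ⟨j, hj⟩)
  rw [Module.Basis.constr_basis] at h
  rw [← h]
  simp [b, Module.Basis.span_apply]

theorem mul_mul_diagonal_eq {A : Matrix α β ℝ} {L : Matrix β α ℝ}
    {s : Finset β} (hL : ∀ j ∈ s, L.mulVec (A.col j) = Pi.single j 1) {d : β → ℝ}
    (hd : ∀ j, j ∉ s → d j = 0) :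
    L * (A * Matrix.diagonal d) = Matrix.diagonal d := by
  ext i j
  rw [← Matrix.mul_assoc, Matrix.mul_diagonal]
  by_cases hj : j ∈ s
  · have : (L * A) i j = (Pi.single j 1 : β → ℝ) i := by
      rw [← hL j hj]
      rfl
    rw [this, Matrix.diagonal_apply, Pi.single_apply]
    split_ifs with h <;> simp [h]
  · simp [hd j hj, Matrix.diagonal_apply]
    rintro rfl
    exact (hd i hj).symm

theorem rank_diagonal_eq_card (d : β → ℝ) :
    (Matrix.diagonal d).rank = (Finset.univ.filter fun j => d j ≠ 0).card := by
  rw [Matrix.rank_diagonal, Fintype.card_subtype]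

theorem min_kRank_le_rank_mul_diagonal (A : Matrix α β ℝ) (d : β → ℝ) :
    min (kRank A) (Finset.univ.filter fun j => d j ≠ 0).card ≤ (A * Matrix.diagonal d).rank := by
  obtain ⟨s, hs, hcard⟩ := Finset.exists_subset_card_eq
    (min_le_right (kRank A) (Finset.univ.filter fun j => d j ≠ 0).card)
  have hds : ∀ j ∈ s, d j ≠ 0 := fun j hj => by simpa using hs hj
  obtain ⟨L, hL⟩ := exists_mulVec_col_eq_single A (hcard.le.trans (min_le_left _ _))
  let e : β → ℝ := fun j => if j ∈ s then 1 else 0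
  have h1 := mul_mul_diagonal_eq hL (d := e) fun j hj => if_neg hj
  have h2 : Matrix.diagonal e = Matrix.diagonal d * Matrix.diagonal fun j => e j / d j := by
    rw [Matrix.diagonal_mul_diagonal]
    congr 1
    ext j
    by_cases hj : j ∈ s
    · rw [mul_div_cancel₀ _ (hds j hj)]
    · simp [e, hj]
  have h3 : (Matrix.diagonal e).rank = s.card := by
    rw [rank_diagonal_eq_card]
    congr 1
    ext j
    simp [e]
  rw [← hcard, ← h3, ← h1]
  refine (Matrix.rank_mul_le_right _ _).trans ?_
  rw [h2, ← Matrix.mul_assoc]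
  exact Matrix.rank_mul_le_left _ _

/-- **Sylvester's rank inequality.** -/
theorem rank_add_rank_le_rank_mul_add_card {l m n : Type*} [Fintype m] [Fintype n]
    (M : Matrix l m ℝ) (N : Matrix m n ℝ) :
    M.rank + N.rank ≤ (M * N).rank + Fintype.card m := by
  have h1 := LinearMap.finrank_range_add_finrank_ker
    (M.mulVecLin.domRestrict (LinearMap.range N.mulVecLin))
  have h2 := LinearMap.finrank_range_add_finrank_ker M.mulVecLin
  rw [Module.finrank_fintype_fun_eq_card] at h2
  have h3 : LinearMap.range (M.mulVecLin.domRestrict (LinearMap.range N.mulVecLin)) =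
      LinearMap.range (M * N).mulVecLin := by
    rw [LinearMap.range_domRestrict, Matrix.mulVecLin_mul, LinearMap.range_comp]
  have h4 : Module.finrank ℝ
      (LinearMap.ker (M.mulVecLin.domRestrict (LinearMap.range N.mulVecLin))) ≤
      Module.finrank ℝ (LinearMap.ker M.mulVecLin) := by
    refine LinearMap.finrank_le_finrank_of_injective
      (f := (Submodule.subtype _).restrict (p := LinearMap.ker
        (M.mulVecLin.domRestrict (LinearMap.range N.mulVecLin))) fun x hx => ?_) ?_
    · simpa using hx
    · intro x y hxy
      have := congrArg Subtype.val hxy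
      exact Subtype.ext (Subtype.ext this)
  rw [h3] at h1
  unfold Matrix.rank
  omega

/-- If a slice has few nonzero weights in the decomposition `(A', B')`, it has no more nonzero weights
in the decomposition `(A, B)`. -/
theorem card_support_le_of_slice_eq {γ : Type*} [Fintype γ] {A A' : Matrix α β ℝ}
    {B B' : Matrix γ β ℝ} {d d' : β → ℝ} {k : ℕ}
    (h : A * Matrix.diagonal d * B.transpose = A' * Matrix.diagonal d' * B'.transpose)
    (hd' : (Finset.univ.filter fun j => d' j ≠ 0).card + k ≤ Fintype.card β + 1)
    (h1 : 2 * Fintype.card β + 2 ≤ kRank A + B.rank + k)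
    (h2 : Fintype.card β + 2 ≤ kRank B + k) :
    (Finset.univ.filter fun j => d j ≠ 0).card ≤ (Finset.univ.filter fun j => d' j ≠ 0).card := by
  have hub : (A * Matrix.diagonal d * B.transpose).rank ≤
      (Finset.univ.filter fun j => d' j ≠ 0).card := by
    rw [h, ← rank_diagonal_eq_card]
    exact (Matrix.rank_mul_le_left _ _).trans (Matrix.rank_mul_le_right _ _)
  have hA := min_kRank_le_rank_mul_diagonal A d
  have hB := min_kRank_le_rank_mul_diagonal B d
  by_cases hw : (Finset.univ.filter fun j => d j ≠ 0).card ≤ kRank A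
  · obtain ⟨L, hL⟩ := exists_mulVec_col_eq_single A hw
    have h3 := mul_mul_diagonal_eq hL (d := d) fun j hj => by simpa using hj
    have h4 : (B * Matrix.diagonal d).rank ≤ (A * Matrix.diagonal d * B.transpose).rank := by
      rw [← Matrix.rank_transpose, Matrix.transpose_mul, Matrix.diagonal_transpose]
      conv_lhs => rw [← h3, Matrix.mul_assoc]
      exact Matrix.rank_mul_le_right _ _
    omega
  · have h5 := rank_add_rank_le_rank_mul_add_card (A * Matrix.diagonal d) B.transpose
    rw [Matrix.rank_transpose] at h5
    omega

theorem exists_vecMul_eq_one (C : Matrix α β ℝ) {s : Finset β} {r : β} (hr : r ∈ s)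
    (hs : Fintype.card β + 1 ≤ s.card + kRank C) :
    ∃ x : α → ℝ, Matrix.vecMul x C r = 1 ∧ ∀ j, j ∉ s → Matrix.vecMul x C j = 0 := by
  have hcard : (insert r sᶜ).card ≤ kRank C := by
    refine (Finset.card_insert_le _ _).trans ?_
    rw [Finset.card_compl]
    have := Finset.card_le_univ s
    omega
  obtain ⟨L, hL⟩ := exists_mulVec_col_eq_single C hcard
  have key : ∀ j ∈ insert r sᶜ, Matrix.vecMul (L r) C j = (Pi.single j 1 : β → ℝ) r := by
    intro j hj
    rw [← hL j hj]
    rfl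
  refine ⟨L r, ?_, fun j hj => ?_⟩
  · rw [key r (Finset.mem_insert_self _ _), Pi.single_eq_same]
  · rw [key j (Finset.mem_insert_of_mem (Finset.mem_compl.2 hj)), Pi.single_eq_of_ne]
    rintro rfl
    exact hj hr

theorem mul_diagonal_mul_transpose_mul {γ m : Type*} [Fintype γ] {B : Matrix γ β ℝ}
    {L : Matrix β γ ℝ} {s : Finset β} (hL : ∀ j ∈ s, L.mulVec (B.col j) = Pi.single j 1)
    {d : β → ℝ} (hd : ∀ j, j ∉ s → d j = 0) (A : Matrix m β ℝ) :
    A * Matrix.diagonal d * B.transpose * L.transpose = A * Matrix.diagonal d := by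
  have h := congrArg Matrix.transpose (mul_mul_diagonal_eq hL hd)
  simp only [Matrix.transpose_mul, Matrix.diagonal_transpose] at h
  rw [Matrix.mul_assoc, Matrix.mul_assoc, ← Matrix.mul_assoc (Matrix.diagonal d), h]

section CommonFactor

variable {γ δ : Type*} [Fintype γ] [Fintype δ] {A A' : Matrix α β ℝ} {B B' : Matrix γ β ℝ}
  {C : Matrix δ β ℝ}

theorem col_mem_span_of_slices_eq
    (hT : ∀ x, A * Matrix.diagonal (Matrix.vecMul x C) * B.transpose =
      A' * Matrix.diagonal (Matrix.vecMul x C) * B'.transpose)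
    {s : Finset β} {r : β} (hr : r ∈ s) (hs : Fintype.card β + 1 ≤ s.card + kRank C)
    (hA : s.card ≤ kRank A) (hB : s.card ≤ kRank B) :
    A'.col r ∈ Submodule.span ℝ (A.col '' (s : Set β)) := by
  obtain ⟨x, hxr, hxs⟩ := exists_vecMul_eq_one C hr hs
  have h := hT x
  set d := Matrix.vecMul x C
  obtain ⟨L, hL⟩ := exists_mulVec_col_eq_single B hB
  have h1 := congrArg (fun M => M * L.transpose) h
  simp only [mul_diagonal_mul_transpose_mul hL hxs] at h1
  rw [Matrix.mul_assoc, Matrix.mul_assoc] at h1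
  set D : Finset β := Finset.univ.filter fun j => d j ≠ 0 with hD
  have hDs : D ⊆ s := by
    intro j hj
    by_contra hjs
    exact (Finset.mem_filter.1 hj).2 (hxs j hjs)
  have hle : Submodule.span ℝ (A.col '' (D : Set β)) ≤ Submodule.span ℝ (A'.col '' (D : Set β)) := by
    rw [Submodule.span_le]
    rintro _ ⟨i, hi, rfl⟩
    have hi : d i ≠ 0 := by simpa [hD] using hi
    have h2 : d i • A.col i = ∑ j, (d j * (B'.transpose * L.transpose) j i) • A'.col j := by
      ext a
      have h3 := congrFun (congrFun h1 a) i
      rw [Matrix.mul_diagonal, Matrix.mul_apply] at h3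
      simp only [Matrix.diagonal_mul] at h3
      simp only [Pi.smul_apply, Matrix.col_apply, smul_eq_mul, Finset.sum_apply]
      rw [mul_comm, h3]
      exact Finset.sum_congr rfl fun j _ => by ring
    refine (Submodule.smul_mem_iff _ hi).1 ?_
    rw [h2]
    refine Submodule.sum_mem _ fun j _ => ?_
    by_cases hj : d j = 0
    · simp [hj]
    · exact Submodule.smul_mem _ _ (Submodule.subset_span ⟨j, by simpa [hD] using hj, rfl⟩)
  have heq : Submodule.span ℝ (A.col '' (D : Set β)) = Submodule.span ℝ (A'.col '' (D : Set β)) := by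
    refine Submodule.eq_of_le_of_finrank_le hle ?_
    rw [finrank_span_col_image A ((Finset.card_le_card hDs).trans hA)]
    have := finrank_span_finset_le_card (R := ℝ) (D.image A'.col)
    rw [Set.finrank, Finset.coe_image] at this
    exact this.trans Finset.card_image_le
  refine Submodule.span_mono (Set.image_mono (by exact_mod_cast hDs)) (?_ : A'.col r ∈ _)
  rw [heq]
  exact Submodule.subset_span ⟨r, by simp [hD, hxr], rfl⟩

theorem exists_col_eq_smul_of_slices_eq
    (hT : ∀ x, A * Matrix.diagonal (Matrix.vecMul x C) * B.transpose =
      A' * Matrix.diagonal (Matrix.vecMul x C) * B'.transpose)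
    (hC : 2 ≤ kRank C) (hA : Fintype.card β + 2 ≤ kRank A + kRank C)
    (hB : Fintype.card β + 2 ≤ kRank B + kRank C) (r : β) :
    ∃ a : ℝ, A'.col r = a • A.col r := by
  have hCR := kRank_le_card C
  obtain ⟨t, hrt, ht⟩ := Finset.exists_superset_card_eq (s := {r})
    (n := Fintype.card β + 2 - kRank C) (by rw [Finset.card_singleton]; omega) (by omega)
  rw [Finset.singleton_subset_iff] at hrt
  obtain ⟨L, hL⟩ := exists_mulVec_col_eq_single A (s := t) (by omega)
  have hmem : ∀ j ∈ t, j ≠ r →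
      A'.col r ∈ Submodule.span ℝ (A.col '' ((t.erase j : Finset β) : Set β)) := by
    intro j hj hjr
    have := Finset.card_erase_of_mem hj
    exact col_mem_span_of_slices_eq hT (Finset.mem_erase.2 ⟨hjr.symm, hrt⟩)
      (by omega) (by omega) (by omega)
  have hzero : ∀ j ∈ t, j ≠ r → L.mulVec (A'.col r) j = 0 := by
    intro j hj hjr
    have hle : Submodule.span ℝ (A.col '' ((t.erase j : Finset β) : Set β)) ≤
        LinearMap.ker (LinearMap.proj j ∘ₗ L.mulVecLin) := by
      rw [Submodule.span_le]
      rintro _ ⟨i, hi, rfl⟩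
      have hi := Finset.mem_erase.1 (Finset.mem_coe.1 hi)
      simp [hL i hi.2, hi.1.symm]
    simpa using hle (hmem j hj hjr)
  obtain ⟨j, hj, hjr⟩ : ∃ j ∈ t, j ≠ r := Finset.exists_mem_ne (by omega) r
  have hv : A'.col r ∈ Submodule.span ℝ (A.col '' (t : Set β)) :=
    Submodule.span_mono (Set.image_mono (by exact_mod_cast Finset.erase_subset j t)) (hmem j hj hjr)
  obtain ⟨w, hw⟩ := (Submodule.mem_span_image_finset_iff_exists_fun' ℝ).1 hv
  have hwt : ∀ i ∈ t, i ≠ r → w i = 0 := by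
    intro i hi hir
    rw [← hzero i hi hir, ← hw, Matrix.mulVec_sum, Finset.sum_apply,
      Finset.sum_eq_single_of_mem i hi]
    · simp [Matrix.mulVec_smul, hL i hi]
    · intro l hl hli
      simp [Matrix.mulVec_smul, hL l hl, hli.symm]
  refine ⟨w r, ?_⟩
  rw [← hw, Finset.sum_eq_single_of_mem r hrt]
  intro i hi hir
  rw [hwt i hi hir, zero_smul]

/-- If two decompositions share the third factor, they agree up to scaling. -/
theorem exists_smul_of_slices_eq
    (hT : ∀ x, A * Matrix.diagonal (Matrix.vecMul x C) * B.transpose =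
      A' * Matrix.diagonal (Matrix.vecMul x C) * B'.transpose)
    (hC : 2 ≤ kRank C) (hA : Fintype.card β + 2 ≤ kRank A + kRank C)
    (hB : Fintype.card β + 2 ≤ kRank B + kRank C) :
    ∃ a b : β → ℝ, (∀ r, a r * b r = 1) ∧ (∀ i r, A' i r = a r * A i r) ∧
      ∀ i r, B' i r = b r * B i r := by
  have hT' : ∀ x, B * Matrix.diagonal (Matrix.vecMul x C) * A.transpose =
      B' * Matrix.diagonal (Matrix.vecMul x C) * A'.transpose := by
    intro x
    have := congrArg Matrix.transpose (hT x)
    simpa [Matrix.transpose_mul, Matrix.mul_assoc] using this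
  choose a ha using exists_col_eq_smul_of_slices_eq hT hC hA hB
  choose b hb using exists_col_eq_smul_of_slices_eq hT' hC hB hA
  have ha' : A' = A * Matrix.diagonal a := by
    ext i r
    rw [Matrix.mul_diagonal, mul_comm]
    exact congrFun (ha r) i
  have hb' : B' = B * Matrix.diagonal b := by
    ext i r
    rw [Matrix.mul_diagonal, mul_comm]
    exact congrFun (hb r) i
  refine ⟨a, b, fun r => ?_, fun i r => congrFun (ha r) i, fun i r => congrFun (hb r) i⟩
  have hCR := kRank_le_card C
  obtain ⟨s, hrs, hs⟩ := Finset.exists_superset_card_eq (s := {r})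
    (n := Fintype.card β + 1 - kRank C) (by rw [Finset.card_singleton]; omega) (by omega)
  rw [Finset.singleton_subset_iff] at hrs
  obtain ⟨x, hxr, hxs⟩ := exists_vecMul_eq_one C hrs (by omega)
  have h := hT x
  set d := Matrix.vecMul x C
  obtain ⟨LA, hLA⟩ := exists_mulVec_col_eq_single A (s := s) (by omega)
  obtain ⟨LB, hLB⟩ := exists_mulVec_col_eq_single B (s := s) (by omega)
  have h1 : A' * Matrix.diagonal d * B'.transpose =
      A * Matrix.diagonal (fun j => a j * d j * b j) * B.transpose := by
    rw [ha', hb', Matrix.transpose_mul, Matrix.diagonal_transpose, Matrix.mul_assoc A,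
      Matrix.diagonal_mul_diagonal, Matrix.mul_assoc A, ← Matrix.mul_assoc (Matrix.diagonal _),
      Matrix.diagonal_mul_diagonal, ← Matrix.mul_assoc A]
  have h2 := congrArg (fun M => LA * (M * LB.transpose)) (h.trans h1)
  have hxs' : ∀ j, j ∉ s → a j * d j * b j = 0 := fun j hj => by simp [hxs j hj]
  simp only [mul_diagonal_mul_transpose_mul hLB hxs, mul_diagonal_mul_transpose_mul hLB hxs',
    mul_mul_diagonal_eq hLA hxs, mul_mul_diagonal_eq hLA hxs'] at h2
  have h3 := congrFun (congrFun h2 r) r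
  rw [Matrix.diagonal_apply_eq, Matrix.diagonal_apply_eq, hxr] at h3
  linarith

end CommonFactor

end KRank

section CPD

variable {I J K R : ℕ}

theorem slice_eq_of_cpdTensor_eq {S : ℕ} {A : Matrix (Fin I) (Fin R) ℝ}
    {B : Matrix (Fin J) (Fin R) ℝ} {C : Matrix (Fin K) (Fin R) ℝ} {A' : Matrix (Fin I) (Fin S) ℝ}
    {B' : Matrix (Fin J) (Fin S) ℝ} {C' : Matrix (Fin K) (Fin S) ℝ}
    (h : cpdTensor A B C = cpdTensor A' B' C') (x : Fin K → ℝ) :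
    A * Matrix.diagonal (Matrix.vecMul x C) * B.transpose =
      A' * Matrix.diagonal (Matrix.vecMul x C') * B'.transpose := by
  have key : ∀ {Q : ℕ} (A : Matrix (Fin I) (Fin Q) ℝ) (B : Matrix (Fin J) (Fin Q) ℝ)
      (C : Matrix (Fin K) (Fin Q) ℝ) (i : Fin I) (j : Fin J),
      (A * Matrix.diagonal (Matrix.vecMul x C) * B.transpose) i j =
        ∑ k, x k * cpdTensor A B C i j k := by
    intro Q A B C i j
    rw [Matrix.mul_apply]
    simp only [Matrix.mul_diagonal, Matrix.transpose_apply,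
      Matrix.vecMul, dotProduct, cpdTensor, Finset.mul_sum, Finset.sum_mul]
    rw [Finset.sum_comm]
    exact Finset.sum_congr rfl fun k _ => Finset.sum_congr rfl fun r _ => by ring
  ext i j
  rw [key, key, h]

theorem exists_perm_smul_of_cpdTensor_eq {A A' : Matrix (Fin I) (Fin R) ℝ}
    {B B' : Matrix (Fin J) (Fin R) ℝ} {C C' : Matrix (Fin K) (Fin R) ℝ}
    (h1 : 2 * R + 2 ≤ kRank A + B.rank + kRank C) (h2 : R + 2 ≤ kRank B + kRank C)
    (h : cpdTensor A B C = cpdTensor A' B' C') :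
    ∃ (σ : Equiv.Perm (Fin R)) (la lb lc : Fin R → ℝ),
      (∀ r, la r * lb r * lc r = 1) ∧
      (∀ i r, A' i r = la r * A i (σ r)) ∧
      (∀ j r, B' j r = lb r * B j (σ r)) ∧
      (∀ k r, C' k r = lc r * C k (σ r)) := by
  classical
  have hB := kRank_le_card B
  have hCR := kRank_le_card C
  have hBR := B.rank_le_card_width
  rw [Fintype.card_fin] at hB hCR hBR
  have hC2 : 2 ≤ kRank C := by omega
  have hc0 : ∀ j, C.col j ≠ 0 := by
    intro j hj
    obtain ⟨L, hL⟩ := exists_mulVec_col_eq_single C (s := {j}) (by simp; omega)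
    have := congrFun (hL j (Finset.mem_singleton_self j)) j
    simp [hj] at this
  obtain ⟨σ, μ, hμ⟩ := exists_perm_smul_of_card_le C.col C'.col (kRank C) hC2 (by
      obtain ⟨s, -, hs⟩ := Finset.exists_subset_card_eq
        (s := (Finset.univ : Finset (Fin R))) (n := kRank C) (by simpa using hCR)
      conv_lhs => rw [← hs, ← finrank_span_col_image C hs.le]
      exact Submodule.finrank_mono (Submodule.span_mono (Set.image_subset_range _ _)))
    hc0 (by
      intro i j v hi hj
      by_contra hij
      obtain ⟨a, ha⟩ := Submodule.mem_span_singleton.1 hi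
      obtain ⟨b, hb⟩ := Submodule.mem_span_singleton.1 hj
      obtain ⟨L, hL⟩ := exists_mulVec_col_eq_single C (s := {i, j})
        ((Finset.card_le_two).trans hC2)
      have e : b • C.col i = a • C.col j := by rw [← ha, ← hb, smul_comm]
      have e' := congrFun (congrArg L.mulVec e) i
      rw [Matrix.mulVec_smul, Matrix.mulVec_smul, hL i (by simp), hL j (by simp)] at e'
      have hb0 : b = 0 := by simpa [Pi.single_apply, hij] using e'
      exact hc0 j (by rw [← hb, hb0, zero_smul]))
    (by
      intro φ hφ
      let x : Fin K → ℝ := fun k => φ (Pi.single k 1)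
      have hx : ∀ (M : Matrix (Fin K) (Fin R) ℝ) (j : Fin R), φ (M.col j) = Matrix.vecMul x M j := by
        intro M j
        rw [LinearMap.pi_apply_eq_sum_univ φ (M.col j)]
        simp only [Matrix.vecMul, dotProduct, smul_eq_mul, Matrix.col_apply]
        refine Finset.sum_congr rfl fun k _ => ?_
        rw [mul_comm]
        congr 2
        ext i
        simp [Pi.single_apply, eq_comm]
      simp only [hx] at hφ ⊢
      exact card_support_le_of_slice_eq (slice_eq_of_cpdTensor_eq h x) (by convert hφ)
        (by simpa using h1) (by simpa using h2))
  let A₁ : Matrix (Fin I) (Fin R) ℝ := fun i r => μ (σ.symm r) * A' i (σ.symm r)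
  let B₁ : Matrix (Fin J) (Fin R) ℝ := fun j r => B' j (σ.symm r)
  have hC' : ∀ k r, C' k r = μ r * C k (σ r) := fun k r => congrFun (hμ r).2 k
  have hT : cpdTensor A B C = cpdTensor A₁ B₁ C := by
    rw [h]
    ext i j k
    simp only [cpdTensor]
    refine Fintype.sum_equiv σ _ _ fun r => ?_
    simp only [A₁, B₁, Equiv.symm_apply_apply, hC']
    ring
  obtain ⟨a, b, hab, ha, hb⟩ := exists_smul_of_slices_eq (slice_eq_of_cpdTensor_eq hT) hC2
    (by simp; omega) (by simpa using h2)
  refine ⟨σ, fun r => (μ r)⁻¹ * a (σ r), fun r => b (σ r), μ, fun r => ?_, fun i r => ?_,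
    fun j r => ?_, hC'⟩
  · rw [mul_assoc (μ r)⁻¹, hab, mul_one, inv_mul_cancel₀ (hμ r).1]
  · have := ha i (σ r)
    simp only [A₁, Equiv.symm_apply_apply] at this
    rw [mul_assoc, ← this, inv_mul_cancel_left₀ (hμ r).1]
  · have := hb j (σ r)
    simpa only [B₁, Equiv.symm_apply_apply] using this

end CPD

/-- If `k_A + r_B + k_C ≥ 2R + 2` and `k_B + k_C ≥ R + 2`, then the rank
of `T = [A,B,C]_R` equals `R` and the CPD of `T` is unique. -/
theorem stmt6 {I J K R : ℕ} (A : Matrix (Fin I) (Fin R) ℝ) (B : Matrix (Fin J) (Fin R) ℝ)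
    (C : Matrix (Fin K) (Fin R) ℝ)
    (h1 : 2 * R + 2 ≤ kRank A + B.rank + kRank C)
    (h2 : R + 2 ≤ kRank B + kRank C) :
    tensorRank (cpdTensor A B C) = R ∧ cpdUnique R (cpdTensor A B C) := by
  constructor
  · refine le_antisymm (Nat.sInf_le ⟨A, B, C, rfl⟩) (le_csInf ⟨R, A, B, C, rfl⟩ ?_)
    rintro n ⟨A', B', C', h⟩
    by_contra! hn
    obtain ⟨m, rfl⟩ := Nat.exists_eq_add_of_lt hn
    let A₁ : Matrix (Fin I) (Fin (n + m + 1)) ℝ :=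
      fun i => Fin.snoc (Fin.append (A' i) 0 : Fin (n + m) → ℝ) (0 : ℝ)
    let B₁ : Matrix (Fin J) (Fin (n + m + 1)) ℝ :=
      fun j => Fin.snoc (Fin.append (B' j) 0 : Fin (n + m) → ℝ) (0 : ℝ)
    let C₁ : Matrix (Fin K) (Fin (n + m + 1)) ℝ :=
      fun k => Fin.snoc (Fin.append (C' k) 0 : Fin (n + m) → ℝ) (0 : ℝ)
    have hT : cpdTensor A B C = cpdTensor A₁ B₁ C₁ := by
      rw [h]
      ext i j k
      simp [cpdTensor, A₁, B₁, C₁, Fin.sum_univ_castSucc, Fin.sum_univ_add]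
    obtain ⟨σ, la, lb, lc, hl, -, -, hC⟩ := exists_perm_smul_of_cpdTensor_eq h1 h2 hT
    have hB := kRank_le_card B
    rw [Fintype.card_fin] at hB
    obtain ⟨L, hL⟩ := exists_mulVec_col_eq_single C (s := {σ (Fin.last _)})
      (by rw [Finset.card_singleton]; omega)
    have hc : C.col (σ (Fin.last _)) = 0 := by
      ext k
      have hk := hC k (Fin.last _)
      have hlc : lc (Fin.last _) ≠ 0 := by
        intro h0
        simpa [h0] using hl (Fin.last _)
      simpa [C₁, hlc] using hk
    have := congrFun (hL _ (Finset.mem_singleton_self _)) (σ (Fin.last _))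
    simp [hc] at this
  · intro A₁ A₂ B₁ B₂ C₁ C₂ e₁ e₂
    obtain ⟨σ, la, lb, lc, hl, hA, hB, hC⟩ := exists_perm_smul_of_cpdTensor_eq h1 h2 e₁
    obtain ⟨τ, ma, mb, mc, hm, hA', hB', hC'⟩ := exists_perm_smul_of_cpdTensor_eq h1 h2 e₂
    have hne : ∀ r, la r ≠ 0 ∧ lb r ≠ 0 ∧ lc r ≠ 0 := by
      intro r
      refine ⟨fun h => ?_, fun h => ?_, fun h => ?_⟩ <;> simpa [h] using hl r
    refine ⟨τ.trans σ.symm, fun r => ma r / la (σ.symm (τ r)), fun r => mb r / lb (σ.symm (τ r)),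
      fun r => mc r / lc (σ.symm (τ r)), fun r => ?_, fun i r => ?_, fun j r => ?_, fun k r => ?_⟩
    · rw [div_mul_div_comm, div_mul_div_comm, hl, hm, div_one]
    · have := (hne (σ.symm (τ r))).1
      simp only [Equiv.trans_apply, hA, hA', Equiv.apply_symm_apply]
      field_simp
    · have := (hne (σ.symm (τ r))).2.1
      simp only [Equiv.trans_apply, hB, hB', Equiv.apply_symm_apply]
      field_simp
    · have := (hne (σ.symm (τ r))).2.2
      simp only [Equiv.trans_apply, hC, hC', Equiv.apply_symm_apply]
      field_simp
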